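/- Fix q ∈ (0,1), a > 0 and integers m, y ≥ 0. Then ∑_{j=0}^{m} p_{m,a}(j) q^{j y} = ∑_{s=0}^{y} C_{−a}(y,s) q^{s m}. -/

import Mathlib

/-- The q-Pochhammer symbol `(a;q)_n = ∏_{i=0}^{n-1} (1 - a q^i)`. -/
noncomputable def qPoch (q a : ℝ) (n : ℕ) : ℝ := ∏ i ∈ Finset.range n, (1 - a * q ^ i)

/-- The q-deformed truncated geometric distribution
`p_{m,α}(j) = α^j (α;q)_{m-j} (q;q)_m / ((q;q)_{m-j} (q;q)_j)` for `0 ≤ j ≤ m`, `0` otherwise. -/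
noncomputable def pgeo (q α : ℝ) (m : ℕ) (j : ℤ) : ℝ :=
  if 0 ≤ j ∧ j ≤ (m : ℤ) then
    α ^ j.toNat * qPoch q α (m - j.toNat) *
      (qPoch q q m / (qPoch q q (m - j.toNat) * qPoch q q j.toNat))
  else 0

/-- The coefficients `C_a(y,s) = (-a)^s (-a;q)_{y-s} (q;q)_y / ((q;q)_{y-s} (q;q)_s)`
for `0 ≤ s ≤ y`, with the convention `C_a(y,s) = 0` for `s < 0` or `s > y`. -/
noncomputable def Cco (q a : ℝ) (y : ℕ) (s : ℤ) : ℝ :=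
  if 0 ≤ s ∧ s ≤ (y : ℤ) then
    (-a) ^ s.toNat * qPoch q (-a) (y - s.toNat) *
      (qPoch q q y / (qPoch q q (y - s.toNat) * qPoch q q s.toNat))
  else 0

theorem qPoch_zero (q a : ℝ) : qPoch q a 0 = 1 := by simp [qPoch]

theorem qPoch_succ (q a : ℝ) (n : ℕ) : qPoch q a (n + 1) = qPoch q a n * (1 - a * q ^ n) :=
  Finset.prod_range_succ _ _

theorem one_sub_mul_pow_pos {q : ℝ} (hq : q ∈ Set.Ioo (0:ℝ) 1) (n : ℕ) : 0 < 1 - q * q ^ n := by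
  rw [← pow_succ']
  exact sub_pos.2 (pow_lt_one₀ hq.1.le hq.2 n.succ_ne_zero)

theorem qPoch_self_pos {q : ℝ} (hq : q ∈ Set.Ioo (0:ℝ) 1) (n : ℕ) : 0 < qPoch q q n :=
  Finset.prod_pos fun i _ => one_sub_mul_pow_pos hq i

/-- The convolution `∑_{i+j=m} (a;q)_i / (q;q)_i * (a x)^j / (q;q)_j`. -/
noncomputable def qConv (q a : ℝ) (m : ℕ) (x : ℝ) : ℝ :=
  ∑ p ∈ Finset.HasAntidiagonal.antidiagonal m,
    qPoch q a p.1 / qPoch q q p.1 * ((a * x) ^ p.2 / qPoch q q p.2)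

theorem qConv_zero (q a x : ℝ) : qConv q a 0 x = 1 := by
  simp [qConv, qPoch_zero]

theorem one_sub_pow_mul_qConv_succ_one {q : ℝ} (hq : q ∈ Set.Ioo (0:ℝ) 1) (a : ℝ) (m : ℕ) :
    (1 - q ^ (m + 1)) * qConv q a (m + 1) 1 = qConv q a m 1 := by
  have hsplit : (1 - q ^ (m + 1)) * qConv q a (m + 1) 1 =
      (∑ p ∈ Finset.HasAntidiagonal.antidiagonal (m + 1),
        (1 - q ^ p.1) * (qPoch q a p.1 / qPoch q q p.1) * (a ^ p.2 / qPoch q q p.2)) +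
      ∑ p ∈ Finset.HasAntidiagonal.antidiagonal (m + 1),
        q ^ p.1 * (qPoch q a p.1 / qPoch q q p.1) *
          ((1 - q ^ p.2) * (a ^ p.2 / qPoch q q p.2)) := by
    rw [qConv, Finset.mul_sum, ← Finset.sum_add_distrib]
    refine Finset.sum_congr rfl fun p hp => ?_
    rw [← Finset.HasAntidiagonal.mem_antidiagonal.1 hp, pow_add, mul_one]
    ring
  rw [hsplit, Finset.Nat.sum_antidiagonal_succ, Finset.Nat.sum_antidiagonal_succ']
  simp only [pow_zero, sub_self, zero_mul, mul_zero, zero_add]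
  rw [← Finset.sum_add_distrib, qConv]
  refine Finset.sum_congr rfl fun p _ => ?_
  have h₁ := (qPoch_self_pos hq p.1).ne'
  have h₂ := (qPoch_self_pos hq p.2).ne'
  have h₃ := (one_sub_mul_pow_pos hq p.1).ne'
  have h₄ := (one_sub_mul_pow_pos hq p.2).ne'
  simp only [qPoch_succ, pow_succ' q, mul_one]
  field_simp
  ring

theorem qConv_succ_sub {q : ℝ} (hq : q ∈ Set.Ioo (0:ℝ) 1) (a : ℝ) (m : ℕ) (x : ℝ) :
    qConv q a (m + 1) x - qConv q a (m + 1) (q * x) = a * x * qConv q a m x := by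
  rw [qConv, qConv, ← Finset.sum_sub_distrib, Finset.Nat.sum_antidiagonal_succ', qConv,
    Finset.mul_sum]
  simp only [pow_zero, sub_self, zero_add]
  refine Finset.sum_congr rfl fun p _ => ?_
  have h₁ := (qPoch_self_pos hq p.1).ne'
  have h₂ := (qPoch_self_pos hq p.2).ne'
  have h₄ := (one_sub_mul_pow_pos hq p.2).ne'
  simp only [qPoch_succ]
  field_simp
  ring

/-- The `q`-moment `∑_j p_{m,a}(j) q^{j y}`, as a normalised convolution. -/
noncomputable def qMoment (q a : ℝ) (m y : ℕ) : ℝ := qPoch q q m * qConv q a m (q ^ y)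

theorem sum_pgeo_eq_qMoment (q a : ℝ) (m y : ℕ) :
    ∑ j ∈ Finset.range (m + 1), pgeo q a m (j : ℤ) * q ^ (j * y) = qMoment q a m y := by
  rw [qMoment, qConv, Finset.mul_sum, ← Finset.Nat.sum_antidiagonal_swap,
    Finset.Nat.sum_antidiagonal_eq_sum_range_succ_mk]
  refine Finset.sum_congr rfl fun j hj => ?_
  have hjm : (0:ℤ) ≤ j ∧ (j:ℤ) ≤ m := by
    have := Finset.mem_range.1 hj
    omega
  rw [pgeo, if_pos hjm]
  simp only [Int.toNat_natCast, Prod.swap, mul_pow, ← pow_mul, mul_comm y j]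
  ring

theorem Cco_neg (q a : ℝ) (y : ℕ) (s : ℤ) : Cco q (-a) y s = pgeo q a y s := by
  simp [Cco, pgeo]

theorem qMoment_zero_left (q a : ℝ) (y : ℕ) : qMoment q a 0 y = 1 := by
  simp [qMoment, qPoch_zero, qConv_zero]

theorem qMoment_zero_right {q : ℝ} (hq : q ∈ Set.Ioo (0:ℝ) 1) (a : ℝ) (m : ℕ) :
    qMoment q a m 0 = 1 := by
  induction m with
  | zero => exact qMoment_zero_left q a 0
  | succ m ih =>
    rw [← ih, qMoment, qMoment, pow_zero, ← one_sub_pow_mul_qConv_succ_one hq a m, qPoch_succ]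
    ring

theorem qMoment_succ_succ {q : ℝ} (hq : q ∈ Set.Ioo (0:ℝ) 1) (a : ℝ) (m y : ℕ) :
    qMoment q a (m + 1) (y + 1) =
      qMoment q a (m + 1) y - a * q ^ y * (1 - q ^ (m + 1)) * qMoment q a m y := by
  simp only [qMoment, pow_succ' q y, qPoch_succ]
  linear_combination -(qPoch q q m * (1 - q * q ^ m)) * qConv_succ_sub hq a m (q ^ y)

/-- The recurrence of `qMoment_succ_succ` with the roles of the two indices exchanged. -/
theorem qMoment_succ_succ' {q : ℝ} (hq : q ∈ Set.Ioo (0:ℝ) 1) (a : ℝ) (m y : ℕ) :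
    qMoment q a (m + 1) (y + 1) =
      qMoment q a m (y + 1) - a * q ^ m * (1 - q ^ (y + 1)) * qMoment q a m y := by
  induction y generalizing m with
  | zero =>
    rw [qMoment_succ_succ hq]
    cases m with
    | zero =>
      simp only [qMoment_zero_left, qMoment_zero_right hq]
    | succ m =>
      rw [qMoment_succ_succ hq]
      simp only [qMoment_zero_right hq]
      ring
  | succ y ih =>
    rw [qMoment_succ_succ hq]
    cases m with
    | zero =>
      have h := ih 0
      simp only [qMoment_zero_left] at h ⊢
      linear_combination h
    | succ m =>
      rw [qMoment_succ_succ hq a m (y + 1)]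
      linear_combination ih (m + 1) - a * q ^ (y + 1) * (1 - q ^ (m + 1)) * ih m
        + a * q ^ (m + 1) * (1 - q ^ (y + 1)) * qMoment_succ_succ hq a m y

theorem qMoment_comm {q : ℝ} (hq : q ∈ Set.Ioo (0:ℝ) 1) (a : ℝ) (m y : ℕ) :
    qMoment q a m y = qMoment q a y m := by
  induction y generalizing m with
  | zero => rw [qMoment_zero_left, qMoment_zero_right hq]
  | succ y ih =>
    cases m with
    | zero => rw [qMoment_zero_left, qMoment_zero_right hq]
    | succ m => rw [qMoment_succ_succ hq, qMoment_succ_succ' hq, ih, ih]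

theorem stmt_3 (q a : ℝ) (hq : q ∈ Set.Ioo (0:ℝ) 1) (ha : 0 < a) (m y : ℕ) :
    ∑ j ∈ Finset.range (m + 1), pgeo q a m (j : ℤ) * q ^ (j * y)
      = ∑ s ∈ Finset.range (y + 1), Cco q (-a) y (s : ℤ) * q ^ (s * m) := by
  simp only [Cco_neg, sum_pgeo_eq_qMoment]
  exact qMoment_comm hq a m y
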